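/- arXiv:2004.04553 — 2 statements merged into one kernel-verified Lean document; each statement's English description precedes it below -/
import Mathlib

section
/- Let β > 0 and V > 0, and for α > 0 and y > 0, define F_{α,V}(y) = θ₃(βVy)·θ₃(βV/y) + θ₄(αVy)·θ₄(αV/y). There exists α₀ ∈ (0,β] (depending on β and V) such that for every α ∈ (0,α₀) and every y > 0 with y ≠ 1, one has F_{α,V}(y) > F_{α,V}(1); that is, the square lattice is the unique minimizer of the alternating-charge Gaussian energy among two-dimensional rectangular lattices of covolume V. -/
noncomputable section

/-- Jacobi theta function `θ₃(x) = Σ_{k∈ℤ} e^{-πxk²}`. -/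
def theta3 (x : ℝ) : ℝ := ∑' k : ℤ, Real.exp (-Real.pi * x * (k : ℝ) ^ 2)

/-- Jacobi theta function `θ₄(x) = Σ_{k∈ℤ} (-1)^k e^{-πxk²}`. -/
def theta4 (x : ℝ) : ℝ := ∑' k : ℤ, (-1 : ℝ) ^ k * Real.exp (-Real.pi * x * (k : ℝ) ^ 2)

/-- `F_{α,β,V}(y) = θ₃(βVy)θ₃(βV/y) + θ₄(αVy)θ₄(αV/y)`, the (shifted)
alternating-charge Gaussian energy of the rectangular lattice
`√(Vy)ℤ × √(V/y)ℤ`. -/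
def FV (α β V y : ℝ) : ℝ :=
  theta3 (β * V * y) * theta3 (β * V / y) + theta4 (α * V * y) * theta4 (α * V / y)

open Filter Topology MeasureTheory

lemma integral_count_eq_tsum (f : ℤ → ℝ) :
    ∫ n, f n ∂(Measure.count : Measure ℤ) = ∑' n, f n := by
  by_cases hf : Summable f
  · rw [integral_countable (integrable_count_iff.2 hf.norm)]
    simp [Measure.real]
  · rw [tsum_eq_zero_of_not_summable hf, integral_undef]
    rwa [integrable_count_iff, summable_norm_iff]

/-- The sum `Σ_{n∈ℤ} (πn²)^k e^{-πxn²}`, which is `(-1)^k` times the `k`-th derivative of `θ₃`. -/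
def thetaMoment (k : ℕ) (x : ℝ) : ℝ :=
  ∑' n : ℤ, (Real.pi * (n : ℝ) ^ 2) ^ k * Real.exp (-x * (Real.pi * (n : ℝ) ^ 2))

lemma thetaMoment_zero : thetaMoment 0 = theta3 := by
  ext x
  simp only [thetaMoment, theta3, pow_zero, one_mul]
  exact tsum_congr fun n => by ring_nf

lemma neg_mem_interior_integrableExpSet {x : ℝ} (hx : 0 < x) :
    -x ∈ interior (ProbabilityTheory.integrableExpSet
      (fun n : ℤ => Real.pi * (n : ℝ) ^ 2) Measure.count) := by
  refine mem_interior.2 ⟨Set.Iio 0, fun t ht => ?_, isOpen_Iio, by simpa using hx⟩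
  have h := (HurwitzZeta.hasSum_int_evenKernel 0 (neg_pos.2 (Set.mem_Iio.1 ht))).summable
  refine integrable_count_iff.2 (h.congr fun n => ?_).norm
  ring_nf

lemma summable_thetaMoment (k : ℕ) {x : ℝ} (hx : 0 < x) :
    Summable fun n : ℤ =>
      (Real.pi * (n : ℝ) ^ 2) ^ k * Real.exp (-x * (Real.pi * (n : ℝ) ^ 2)) :=
  (integrable_count_iff.1
    (ProbabilityTheory.integrable_pow_mul_exp_of_mem_interior_integrableExpSet
      (neg_mem_interior_integrableExpSet hx) k)).of_norm

lemma hasDerivAt_thetaMoment (k : ℕ) {x : ℝ} (hx : 0 < x) :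
    HasDerivAt (thetaMoment k) (-thetaMoment (k + 1) x) x := by
  have h := ProbabilityTheory.hasDerivAt_integral_pow_mul_exp_real
    (neg_mem_interior_integrableExpSet hx) k
  simp only [integral_count_eq_tsum] at h
  exact (h.comp x (hasDerivAt_neg x)).congr_deriv (mul_neg_one _)

lemma tsum_sq_le_tsum_mul_tsum {ι : Type*} {f g h : ι → ℝ} (hf : Summable f) (hg : Summable g)
    (hh : Summable h) (hf0 : ∀ i, 0 ≤ f i) (hh0 : ∀ i, 0 ≤ h i)
    (hle : ∀ i, g i ^ 2 ≤ f i * h i) :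
    (∑' i, g i) ^ 2 ≤ (∑' i, f i) * ∑' i, h i := by
  have key : ∀ t : ℝ, 0 ≤ (∑' i, f i) * (t * t) + (2 * ∑' i, g i) * t + ∑' i, h i := by
    intro t
    rw [← tsum_mul_right, ← tsum_mul_left, ← tsum_mul_right,
      ← (hf.mul_right _).tsum_add ((hg.mul_left _).mul_right _),
      ← ((hf.mul_right _).add ((hg.mul_left _).mul_right _)).tsum_add hh]
    refine tsum_nonneg fun i => ?_
    rcases (hf0 i).eq_or_lt with h0 | h0
    · have : g i = 0 := by
        have := hle i
        rw [← h0, zero_mul] at this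
        exact pow_eq_zero_iff two_ne_zero |>.1 (le_antisymm this (sq_nonneg _))
      rw [← h0, this]
      simpa using hh0 i
    · refine nonneg_of_mul_nonneg_right ?_ h0
      nlinarith [hle i, sq_nonneg (f i * t + g i)]
  have := discrim_le_zero key
  rw [discrim] at this
  linarith

lemma thetaMoment_nonneg (k : ℕ) (x : ℝ) : 0 ≤ thetaMoment k x :=
  tsum_nonneg fun n => by positivity

lemma thetaMoment_one_pos {x : ℝ} (hx : 0 < x) : 0 < thetaMoment 1 x :=
  (summable_thetaMoment 1 hx).tsum_pos (fun n => by positivity) 1 (by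
    have := Real.pi_pos
    simp only [Int.cast_one]
    positivity)

lemma theta3_pos {x : ℝ} (hx : 0 < x) : 0 < theta3 x := by
  rw [← thetaMoment_zero]
  exact (summable_thetaMoment 0 hx).tsum_pos (fun n => by positivity) 0 (by simp)

lemma pi_mul_thetaMoment_one_le {x : ℝ} (hx : 0 < x) :
    Real.pi * thetaMoment 1 x ≤ thetaMoment 2 x := by
  rw [thetaMoment, ← tsum_mul_left]
  refine ((summable_thetaMoment 1 hx).mul_left _).tsum_le_tsum (fun n => ?_)
    (summable_thetaMoment 2 hx)
  rw [← mul_assoc]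
  refine mul_le_mul_of_nonneg_right ?_ (Real.exp_pos _).le
  have hn : (n : ℝ) ^ 2 ≤ ((n : ℝ) ^ 2) ^ 2 := by
    have : n ^ 2 ≤ (n ^ 2) ^ 2 := Int.le_self_sq _
    exact_mod_cast this
  nlinarith [mul_le_mul_of_nonneg_left hn (sq_nonneg Real.pi)]

lemma thetaMoment_one_sq_le {x : ℝ} (hx : 0 < x) :
    thetaMoment 1 x ^ 2 ≤ (theta3 x - 1) * thetaMoment 2 x := by
  have h0 := (summable_thetaMoment 0 hx).hasSum.sub (hasSum_pi_single (0 : ℤ) (1 : ℝ))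
  have hval : ∀ n : ℤ, (Real.pi * (n : ℝ) ^ 2) ^ 0 * Real.exp (-x * (Real.pi * (n : ℝ) ^ 2))
      - (Pi.single (0 : ℤ) (1 : ℝ) : ℤ → ℝ) n
      = if n = 0 then 0 else Real.exp (-x * (Real.pi * (n : ℝ) ^ 2)) := by
    intro n
    by_cases hn : n = 0 <;> simp [hn]
  rw [← thetaMoment_zero]
  have := tsum_sq_le_tsum_mul_tsum h0.summable (summable_thetaMoment 1 hx)
    (summable_thetaMoment 2 hx) (fun n => ?_) (fun n => by positivity) (fun n => ?_)
  · rwa [h0.tsum_eq] at this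
  · rw [hval]; split_ifs <;> positivity
  · rw [hval]; split_ifs with hn
    · simp [hn]
    · apply le_of_eq; ring

lemma theta3_lt_pi {x : ℝ} (hx : 1 ≤ x) : theta3 x < Real.pi := by
  have h := norm_jacobiTheta_sub_one_le (τ := Complex.I * x) (by simp; linarith)
  have hj : jacobiTheta (Complex.I * x) = (theta3 x : ℂ) := by
    rw [jacobiTheta, theta3, Complex.ofReal_tsum]
    refine tsum_congr fun n => ?_
    push_cast
    congr 1
    linear_combination (Real.pi * (n : ℂ) ^ 2 * x) * Complex.I_sq
  have him : (Complex.I * x).im = x := by simp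
  rw [hj, him, ← Complex.ofReal_one, ← Complex.ofReal_sub, Complex.norm_real] at h
  have hq : Real.exp (-Real.pi * x) ≤ 1 / 3 := by
    have : Real.exp (-Real.pi * x) * (Real.pi * x + 1) ≤ 1 := by
      have h1 := mul_le_mul_of_nonneg_left (Real.add_one_le_exp (Real.pi * x))
        (Real.exp_pos (-Real.pi * x)).le
      rwa [← Real.exp_add, show -Real.pi * x + Real.pi * x = 0 by ring, Real.exp_zero] at h1
    have : 3 ≤ Real.pi * x + 1 := by nlinarith [Real.pi_gt_three]
    nlinarith [Real.exp_pos (-Real.pi * x)]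
  have hb : 2 / (1 - Real.exp (-Real.pi * x)) * Real.exp (-Real.pi * x) ≤ 1 := by
    rw [div_mul_eq_mul_div, div_le_one (by linarith)]
    linarith
  linarith [le_abs_self (theta3 x - 1), Real.norm_eq_abs (theta3 x - 1), Real.pi_gt_three]

/-- The logarithmic derivative `x ↦ x θ₃'(x) / θ₃(x)` at `x = e^s`. -/
def thetaLogDeriv (s : ℝ) : ℝ :=
  -(Real.exp s * thetaMoment 1 (Real.exp s)) / theta3 (Real.exp s)

/-- The second derivative of `s ↦ log θ₃(e^s)`. -/
def thetaLogDeriv2 (s : ℝ) : ℝ :=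
  (Real.exp s * (Real.exp s * thetaMoment 2 (Real.exp s) * theta3 (Real.exp s)
    - thetaMoment 1 (Real.exp s) * theta3 (Real.exp s)
    - Real.exp s * thetaMoment 1 (Real.exp s) ^ 2)) / theta3 (Real.exp s) ^ 2

lemma hasDerivAt_thetaMoment_exp (k : ℕ) (s : ℝ) :
    HasDerivAt (fun s => thetaMoment k (Real.exp s))
      (-thetaMoment (k + 1) (Real.exp s) * Real.exp s) s :=
  (hasDerivAt_thetaMoment k (Real.exp_pos s)).comp s (Real.hasDerivAt_exp s)

lemma hasDerivAt_theta3_exp (s : ℝ) :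
    HasDerivAt (fun s => theta3 (Real.exp s)) (-thetaMoment 1 (Real.exp s) * Real.exp s) s := by
  simpa [thetaMoment_zero] using hasDerivAt_thetaMoment_exp 0 s

lemma hasDerivAt_log_theta3_exp (s : ℝ) :
    HasDerivAt (fun s => Real.log (theta3 (Real.exp s))) (thetaLogDeriv s) s := by
  convert (hasDerivAt_theta3_exp s).log (theta3_pos (Real.exp_pos s)).ne' using 1
  rw [thetaLogDeriv]
  ring

lemma hasDerivAt_thetaLogDeriv (s : ℝ) :
    HasDerivAt thetaLogDeriv (thetaLogDeriv2 s) s := by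
  have h0 := (theta3_pos (Real.exp_pos s)).ne'
  refine ((((Real.hasDerivAt_exp s).mul (hasDerivAt_thetaMoment_exp 1 s)).neg).div
    (hasDerivAt_theta3_exp s) h0).congr_deriv ?_
  rw [thetaLogDeriv2]
  congr 1
  simp only [Pi.mul_apply, Pi.neg_apply]
  ring

lemma continuous_thetaLogDeriv2 : Continuous thetaLogDeriv2 := by
  have hM (k : ℕ) : Continuous fun s => thetaMoment k (Real.exp s) :=
    continuous_iff_continuousAt.2 fun s => (hasDerivAt_thetaMoment_exp k s).continuousAt
  have h0 : Continuous fun s => theta3 (Real.exp s) := by simpa [thetaMoment_zero] using hM 0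
  have h1 := hM 1
  have h2 := hM 2
  have hexp := Real.continuous_exp
  unfold thetaLogDeriv2
  refine Continuous.div (by fun_prop) (by fun_prop) fun s => ?_
  exact (pow_pos (theta3_pos (Real.exp_pos s)) 2).ne'

lemma log_theta3_exp_neg (s : ℝ) :
    Real.log (theta3 (Real.exp (-s))) = Real.log (theta3 (Real.exp s)) + s / 2 := by
  have h := Real.tsum_exp_neg_mul_int_sq (Real.exp_pos s)
  have h' : theta3 (Real.exp s) = Real.exp (-(s / 2)) * theta3 (Real.exp (-s)) := by
    rw [theta3, h, ← Real.exp_mul, one_div, ← Real.exp_neg, theta3]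
    simp only [Real.exp_neg, div_eq_mul_inv, one_mul]
  rw [h', Real.log_mul (Real.exp_pos _).ne' (theta3_pos (Real.exp_pos _)).ne', Real.log_exp]
  ring

lemma thetaLogDeriv2_neg (s : ℝ) : thetaLogDeriv2 (-s) = thetaLogDeriv2 s := by
  have h1 (s : ℝ) : -thetaLogDeriv (-s) = thetaLogDeriv s + 1 / 2 := by
    have ha := (hasDerivAt_log_theta3_exp (-s)).comp s (hasDerivAt_neg s)
    have hb := (hasDerivAt_log_theta3_exp s).add ((hasDerivAt_id s).div_const 2)
    have he : (fun s => Real.log (theta3 (Real.exp s))) ∘ Neg.neg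
        = (fun s => Real.log (theta3 (Real.exp s))) + fun s => id s / 2 :=
      funext log_theta3_exp_neg
    have := ha.unique (he ▸ hb)
    linarith
  have ha := ((hasDerivAt_thetaLogDeriv (-s)).comp s (hasDerivAt_neg s)).neg
  have hb := (hasDerivAt_thetaLogDeriv s).add_const (1 / 2)
  have he : -(thetaLogDeriv ∘ Neg.neg) = fun s => thetaLogDeriv s + 1 / 2 := funext h1
  have := ha.unique (he ▸ hb)
  linarith

lemma thetaLogDeriv2_pos (s : ℝ) : 0 < thetaLogDeriv2 s := by
  wlog hs : 0 ≤ s generalizing s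
  · rw [← thetaLogDeriv2_neg]
    exact this (-s) (by linarith)
  have hx : 1 ≤ Real.exp s := Real.one_le_exp hs
  set x := Real.exp s
  have hx0 : 0 < x := by linarith
  refine div_pos (mul_pos hx0 ?_) (pow_pos (theta3_pos hx0) 2)
  have h1 := thetaMoment_one_pos hx0
  have h2 := pi_mul_thetaMoment_one_le hx0
  have h3 := mul_le_mul_of_nonneg_left (thetaMoment_one_sq_le hx0) hx0.le
  have h4 := mul_lt_mul_of_pos_left (theta3_lt_pi hx) h1
  have h5 := mul_le_mul_of_nonneg_right hx (thetaMoment_nonneg 2 x)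
  linarith

/-- A convex even function is smallest at `0`; with a second derivative bounded below by `m` on
`[-1, 1]` it grows at least like `m/2 · min(1, t²)`. -/
lemma exists_pos_mul_min_one_sq_le_of_deriv2_pos {f f' f'' : ℝ → ℝ}
    (hf : ∀ t, HasDerivAt f (f' t) t) (hf' : ∀ t, HasDerivAt f' (f'' t) t)
    (hcont : Continuous f'') (hpos : ∀ t, 0 < f'' t) (heven : ∀ t, f (-t) = f t) :
    ∃ m : ℝ, 0 < m ∧ ∀ t, m * min 1 (t ^ 2) ≤ f t - f 0 := by
  obtain ⟨t₀, -, ht₀⟩ := (isCompact_Icc (a := (-1 : ℝ)) (b := 1)).exists_isMinOn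
    ⟨0, by norm_num⟩ hcont.continuousOn
  have hconv : ConvexOn ℝ Set.univ f :=
    convexOn_of_hasDerivWithinAt2_nonneg convex_univ
      (fun t _ => (hf t).continuousAt.continuousWithinAt)
      (fun t _ => (hf t).hasDerivWithinAt) (fun t _ => (hf' t).hasDerivWithinAt)
      (fun t _ => (hpos t).le)
  have hconv' : ConvexOn ℝ (Set.Icc (-1) 1) fun t => f t - f'' t₀ / 2 * t ^ 2 := by
    have h1 (t : ℝ) : HasDerivAt (fun t => f t - f'' t₀ / 2 * t ^ 2) (f' t - f'' t₀ * t) t :=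
      ((hf t).sub ((hasDerivAt_pow 2 t).const_mul (f'' t₀ / 2))).congr_deriv (by
        simp only [Nat.cast_ofNat]; ring)
    have h2 (t : ℝ) : HasDerivAt (fun t => f' t - f'' t₀ * t) (f'' t - f'' t₀) t :=
      ((hf' t).sub ((hasDerivAt_id t).const_mul (f'' t₀))).congr_deriv (by ring)
    exact convexOn_of_hasDerivWithinAt2_nonneg (convex_Icc _ _)
      (fun t _ => (h1 t).continuousAt.continuousWithinAt)
      (fun t _ => (h1 t).hasDerivWithinAt) (fun t _ => (h2 t).hasDerivWithinAt)
      (fun t ht => sub_nonneg.2 (ht₀ (interior_subset ht)))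
  have hsmall : ∀ t ∈ Set.Icc (-1 : ℝ) 1, f'' t₀ / 2 * t ^ 2 ≤ f t - f 0 := by
    intro t ht
    have ht' : -t ∈ Set.Icc (-1 : ℝ) 1 := ⟨by linarith [ht.2], by linarith [ht.1]⟩
    have := hconv'.2 ht ht' one_half_pos.le one_half_pos.le (add_halves 1)
    simp only [smul_eq_mul, heven] at this
    rw [show 1 / 2 * t + 1 / 2 * -t = 0 by ring] at this
    linarith
  refine ⟨f'' t₀ / 2, half_pos (hpos t₀), fun t => ?_⟩
  wlog ht0 : 0 ≤ t generalizing t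
  · simpa [heven] using this (-t) (by linarith)
  rcases le_total t 1 with ht | ht
  · exact (mul_le_mul_of_nonneg_left (min_le_right _ _) (half_pos (hpos t₀)).le).trans
      (hsmall t ⟨by linarith, ht⟩)
  · have h1 := hsmall 1 (by norm_num)
    have h2 : f 1 ≤ f t := by
      have ht' : 0 < t := by linarith
      have ha : 0 ≤ (1 + 1 / t) / 2 := by positivity
      have hb : 0 ≤ (1 - 1 / t) / 2 := by
        have := (div_le_one ht').2 ht
        linarith
      have := hconv.2 (Set.mem_univ t) (Set.mem_univ (-t)) ha hb (by ring)
      simp only [smul_eq_mul, heven] at this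
      rw [show (1 + 1 / t) / 2 * t + (1 - 1 / t) / 2 * -t = 1 by field_simp; ring] at this
      linarith
    rw [min_eq_left (by nlinarith)]
    linarith

lemma cosh_sub_one_le_sq {t : ℝ} (ht : t ^ 2 ≤ 1) : Real.cosh t - 1 ≤ t ^ 2 := by
  have h1 := Real.cosh_le_exp_half_sq t
  have h2 := Real.exp_bound_div_one_sub_of_interval (x := t ^ 2 / 2) (by positivity) (by linarith)
  have h3 : 1 / (1 - t ^ 2 / 2) ≤ 1 + t ^ 2 := by
    rw [div_le_iff₀ (by linarith)]
    nlinarith [sq_nonneg t]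
  linarith

lemma exists_pos_mul_le_theta3_mul_theta3_sub {x : ℝ} (hx : 0 < x) :
    ∃ c : ℝ, 0 < c ∧ ∀ y : ℝ, 0 < y → c * min 1 (Real.cosh (Real.log y) - 1) ≤
      theta3 (x * y) * theta3 (x / y) - theta3 x * theta3 x := by
  set s := Real.log x
  have hs : Real.exp s = x := Real.exp_log hx
  let φ : ℝ → ℝ := fun s => Real.log (theta3 (Real.exp s))
  have hadd (t : ℝ) := (hasDerivAt_id t).const_add s
  have hsub (t : ℝ) := (hasDerivAt_id t).const_sub s
  obtain ⟨m, hm, hmin⟩ := exists_pos_mul_min_one_sq_le_of_deriv2_pos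
    (f := fun t => φ (s + t) + φ (s - t))
    (f' := fun t => thetaLogDeriv (s + t) - thetaLogDeriv (s - t))
    (f'' := fun t => thetaLogDeriv2 (s + t) + thetaLogDeriv2 (s - t))
    (fun t => (((hasDerivAt_log_theta3_exp _).comp t (hadd t)).add
      ((hasDerivAt_log_theta3_exp _).comp t (hsub t))).congr_deriv (by simp only [id]; ring))
    (fun t => (((hasDerivAt_thetaLogDeriv _).comp t (hadd t)).sub
      ((hasDerivAt_thetaLogDeriv _).comp t (hsub t))).congr_deriv (by simp only [id]; ring))
    (by have := continuous_thetaLogDeriv2; fun_prop)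
    (fun t => add_pos (thetaLogDeriv2_pos _) (thetaLogDeriv2_pos _))
    (fun t => by
      simp only [sub_neg_eq_add, ← sub_eq_add_neg, add_comm (φ (s + t))])
  have hθ := theta3_pos hx
  refine ⟨theta3 x * theta3 x * m, by positivity, fun y hy => ?_⟩
  have hexp (a : ℝ) : Real.exp (φ a) = theta3 (Real.exp a) :=
    Real.exp_log (theta3_pos (Real.exp_pos a))
  have hprod (t : ℝ) : Real.exp (φ (s + t) + φ (s - t))
      = theta3 (x * Real.exp t) * theta3 (x / Real.exp t) := by
    rw [Real.exp_add, hexp, hexp, Real.exp_add, Real.exp_sub, hs]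
  have hy' := hprod (Real.log y)
  have h0 := hprod 0
  rw [Real.exp_log hy] at hy'
  rw [Real.exp_zero, mul_one, div_one] at h0
  have hmono : min 1 (Real.cosh (Real.log y) - 1) ≤ min 1 (Real.log y ^ 2) := by
    rcases le_total (Real.log y ^ 2) 1 with h | h
    · rw [min_eq_right h]
      exact (min_le_right _ _).trans (cosh_sub_one_le_sq h)
    · rw [min_eq_left h]
      exact min_le_left _ _
  have h1 := (mul_le_mul_of_nonneg_left hmono hm.le).trans (hmin (Real.log y))
  set a := φ (s + Real.log y) + φ (s - Real.log y)
  set b := φ (s + 0) + φ (s - 0)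
  have h2 : Real.exp a = Real.exp b * Real.exp (a - b) := by
    rw [← Real.exp_add]; ring_nf
  rw [← hy', h2, h0, mul_assoc]
  have h3 := mul_le_mul_of_nonneg_left (h1.trans
    (le_sub_iff_add_le.2 (Real.add_one_le_exp (a - b)))) (mul_pos hθ hθ).le
  linarith

/-- The sum `Σ_{n∈ℤ} e^{-π(n+1/2)²z}`, dual to `θ₄` under Poisson summation. -/
def theta2 (z : ℝ) : ℝ := ∑' n : ℤ, Real.exp (-Real.pi * ((n : ℝ) + (1 / 2 : ℝ)) ^ 2 * z)

lemma summable_theta2 {z : ℝ} (hz : 0 < z) :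
    Summable fun n : ℤ => Real.exp (-Real.pi * ((n : ℝ) + (1 / 2 : ℝ)) ^ 2 * z) :=
  (HurwitzZeta.hasSum_int_evenKernel (1 / 2) hz).summable

lemma theta2_nonneg (z : ℝ) : 0 ≤ theta2 z := tsum_nonneg fun _ => (Real.exp_pos _).le

lemma sqrt_mul_theta4 {x : ℝ} (hx : 0 < x) : √x * theta4 x = theta2 (1 / x) := by
  have h := HurwitzZeta.evenKernel_functional_equation ((1 / 2 : ℝ) : UnitAddCircle) (1 / x)
  rw [← (HurwitzZeta.hasSum_int_evenKernel (1 / 2) (one_div_pos.2 hx)).tsum_eq,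
    one_div_one_div, ← Real.sqrt_eq_rpow, Real.sqrt_div zero_le_one, Real.sqrt_one,
    one_div_one_div] at h
  rw [theta2, h]
  congr 1
  have hc := (HurwitzZeta.hasSum_int_cosKernel (1 / 2) hx).tsum_eq
  rw [← Complex.ofReal_inj, ← hc, theta4, Complex.ofReal_tsum]
  refine tsum_congr fun n => ?_
  have he : Complex.exp (2 * Real.pi * Complex.I * ((1 / 2 : ℝ) : ℂ) * n) = (-1) ^ n := by
    rw [← Complex.exp_pi_mul_I, ← Complex.exp_int_mul]
    push_cast
    ring_nf
  rw [he]
  push_cast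
  ring_nf

lemma theta4_mul_theta4 {x y : ℝ} (hx : 0 < x) (hy : 0 < y) :
    theta4 (x * y) * theta4 (x / y) = 1 / x * (theta2 (1 / x / y) * theta2 (1 / x * y)) := by
  have h1 := sqrt_mul_theta4 (mul_pos hx hy)
  have h2 := sqrt_mul_theta4 (div_pos hx hy)
  rw [show 1 / (x * y) = 1 / x / y by field_simp] at h1
  rw [show 1 / (x / y) = 1 / x * y by field_simp] at h2
  have h3 : √(x * y) * √(x / y) = x := by
    rw [← Real.sqrt_mul (mul_pos hx hy).le, show x * y * (x / y) = x * x by field_simp,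
      Real.sqrt_mul_self hx.le]
  rw [← h1, ← h2, eq_comm, one_div, inv_mul_eq_iff_eq_mul₀ hx.ne']
  linear_combination theta4 (x * y) * theta4 (x / y) * h3

lemma theta2_mul_cosh_sq_le {w y : ℝ} (hw : 0 < w) (hy : 0 < y) :
    theta2 (w * Real.cosh (Real.log y)) ^ 2 ≤ theta2 (w / y) * theta2 (w * y) := by
  refine tsum_sq_le_tsum_mul_tsum (summable_theta2 (by positivity)) (summable_theta2 (by positivity))
    (summable_theta2 (by positivity)) (fun _ => (Real.exp_pos _).le) (fun _ => (Real.exp_pos _).le)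
    fun _ => le_of_eq ?_
  rw [← Real.exp_add, ← Real.exp_nat_mul, Real.cosh_log hy]
  congr 1
  push_cast
  ring

lemma theta2_sub_theta2_mul_le {w c : ℝ} (hw : 0 < w) (hc : 1 ≤ c) :
    theta2 w - theta2 (w * c) ≤ (c - 1) * theta2 (w / 2) := by
  have hwc : 0 < w * c := by positivity
  rw [theta2, theta2, theta2, ← (summable_theta2 hw).tsum_sub (summable_theta2 hwc),
    ← tsum_mul_left]
  refine ((summable_theta2 hw).sub (summable_theta2 hwc)).tsum_le_tsum (fun n => ?_)
    ((summable_theta2 (half_pos hw)).mul_left _)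
  set u := Real.pi * ((n : ℝ) + 1 / 2) ^ 2 * w with hu
  have hu0 : 0 ≤ u := by positivity
  rw [show -Real.pi * ((n : ℝ) + 1 / 2) ^ 2 * w = -u by rw [hu]; ring,
    show -Real.pi * ((n : ℝ) + 1 / 2) ^ 2 * (w * c) = -u + -(u * (c - 1)) by rw [hu]; ring,
    show -Real.pi * ((n : ℝ) + 1 / 2) ^ 2 * (w / 2) = -u + u / 2 by rw [hu]; ring,
    Real.exp_add, Real.exp_add]
  have h1 := Real.add_one_le_exp (-(u * (c - 1)))
  have h2 : u ≤ Real.exp (u / 2) := by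
    have := Real.quadratic_le_exp_of_nonneg (x := u / 2) (by positivity)
    nlinarith [sq_nonneg (u / 2 - 1)]
  have h3 := mul_le_mul_of_nonneg_left h2 (sub_nonneg.2 hc)
  nlinarith [Real.exp_pos (-u)]

lemma theta2_antitone {w z : ℝ} (hw : 0 < w) (hwz : w ≤ z) : theta2 z ≤ theta2 w := by
  refine (summable_theta2 (hw.trans_le hwz)).tsum_le_tsum (fun n => ?_) (summable_theta2 hw)
  have := mul_le_mul_of_nonneg_left hwz
    (mul_nonneg Real.pi_pos.le (sq_nonneg ((n : ℝ) + 1 / 2)))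
  exact Real.exp_le_exp.2 (by linarith)

lemma theta2_add_le {w z : ℝ} (hw : 0 < w) (hz : 0 ≤ z) :
    theta2 (w + z) ≤ Real.exp (-(Real.pi / 4 * z)) * theta2 w := by
  rw [theta2, theta2, ← tsum_mul_left]
  refine (summable_theta2 (by positivity)).tsum_le_tsum (fun n => ?_)
    ((summable_theta2 hw).mul_left _)
  rw [← Real.exp_add]
  have hn : (1 / 4 : ℝ) ≤ ((n : ℝ) + 1 / 2) ^ 2 := by
    have : 0 ≤ n * (n + 1) := by
      rcases le_or_gt 0 n with h | h <;> nlinarith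
    have : (0 : ℝ) ≤ n * (n + 1) := by exact_mod_cast this
    linarith
  have := mul_le_mul_of_nonneg_left (mul_le_mul_of_nonneg_right hn hz) Real.pi_pos.le
  exact Real.exp_le_exp.2 (by linarith)

lemma tendsto_mul_theta2_sq_atTop :
    Tendsto (fun w => 2 * w * theta2 (w / 2) ^ 2) atTop (𝓝 0) := by
  have h := (tendsto_rpow_mul_exp_neg_mul_atTop_nhds_zero 1 (Real.pi / 4) (by positivity)).const_mul
    (2 * Real.exp (Real.pi / 2) * theta2 1 ^ 2)
  rw [mul_zero] at h
  refine tendsto_of_tendsto_of_tendsto_of_le_of_le' tendsto_const_nhds h ?_ ?_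
  · filter_upwards [eventually_ge_atTop 0] with w hw
    positivity
  · filter_upwards [eventually_ge_atTop 2] with w hw
    have hz : 0 ≤ w / 2 - 1 := by linarith
    have hle := pow_le_pow_left₀ (theta2_nonneg _) (theta2_add_le one_pos hz) 2
    rw [add_sub_cancel, mul_pow, ← Real.exp_nat_mul,
      show ((2 : ℕ) : ℝ) * -(Real.pi / 4 * (w / 2 - 1)) = Real.pi / 2 + -(Real.pi / 4) * w by
        push_cast; ring, Real.exp_add] at hle
    rw [Real.rpow_one]
    have := mul_le_mul_of_nonneg_left hle (show 0 ≤ 2 * w by linarith)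
    linarith

lemma theta4_mul_theta4_sub_le {x y : ℝ} (hx : 0 < x) (hy : 0 < y) :
    theta4 x * theta4 x - theta4 (x * y) * theta4 (x / y) ≤
      2 * (1 / x) * theta2 (1 / x / 2) ^ 2 * min 1 (Real.cosh (Real.log y) - 1) := by
  have h1 := theta4_mul_theta4 hx one_pos
  rw [mul_one, div_one, div_one, mul_one] at h1
  rw [h1, theta4_mul_theta4 hx hy]
  set w := 1 / x
  have hw : 0 < w := one_div_pos.2 hx
  have hc := Real.one_le_cosh (Real.log y)
  have hCS := theta2_mul_cosh_sq_le hw hy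
  have hE := theta2_antitone (half_pos hw) (half_le_self hw.le)
  have hE0 := theta2_nonneg w
  have key : theta2 w * theta2 w - theta2 (w / y) * theta2 (w * y) ≤
      2 * theta2 (w / 2) ^ 2 * min 1 (Real.cosh (Real.log y) - 1) := by
    rw [mul_min_of_nonneg _ _ (by positivity)]
    refine le_min ?_ ?_
    · have := mul_nonneg (theta2_nonneg (w / y)) (theta2_nonneg (w * y))
      nlinarith
    · have hd := theta2_sub_theta2_mul_le hw hc
      have hd' := theta2_antitone hw (le_mul_of_one_le_right hw.le hc)
      have hE2 := theta2_nonneg (w * Real.cosh (Real.log y))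
      calc _ ≤ (theta2 w - theta2 (w * Real.cosh (Real.log y))) *
            (theta2 w + theta2 (w * Real.cosh (Real.log y))) := by nlinarith
        _ ≤ ((Real.cosh (Real.log y) - 1) * theta2 (w / 2)) * (2 * theta2 (w / 2)) :=
          mul_le_mul hd (by linarith) (by positivity)
            (mul_nonneg (sub_nonneg.2 hc) (theta2_nonneg _))
        _ = _ := by ring
  have := mul_le_mul_of_nonneg_left key hw.le
  linarith

/-- For fixed `β > 0` and `V > 0`, if `α` is small enough then the square lattice
is the unique minimizer of the alternating-charge Gaussian energy among
rectangular lattices of covolume `V`. -/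
theorem square_unique_minimizer_small_alpha (β V : ℝ) (hβ : 0 < β) (hV : 0 < V) :
    ∃ α₀ : ℝ, 0 < α₀ ∧ α₀ ≤ β ∧ ∀ α : ℝ, 0 < α → α < α₀ →
      ∀ y : ℝ, 0 < y → y ≠ 1 → FV α β V y > FV α β V 1 := by
  obtain ⟨c, hc, hθ₃⟩ := exists_pos_mul_le_theta3_mul_theta3_sub (mul_pos hβ hV)
  obtain ⟨W, hW⟩ := eventually_atTop.1 (tendsto_mul_theta2_sq_atTop.eventually_lt_const hc)
  have hW₁ : 0 < max W 1 := lt_max_of_lt_right one_pos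
  refine ⟨min β (1 / (max W 1 * V)), by positivity, min_le_left _ _, fun α hα hαlt y hy hy1 => ?_⟩
  have hαV : 0 < α * V := mul_pos hα hV
  have hw : W ≤ 1 / (α * V) := by
    refine (le_max_left W 1).trans ((le_div_iff₀ hαV).2 ?_)
    have := (lt_div_iff₀ (mul_pos hW₁ hV)).1 (lt_min_iff.1 hαlt).2
    linarith
  have hmin : 0 < min 1 (Real.cosh (Real.log y) - 1) :=
    lt_min one_pos (sub_pos.2 (Real.one_lt_cosh.2 (Real.log_ne_zero_of_pos_of_ne_one hy hy1)))
  have h1 := hθ₃ y hy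
  have h2 := theta4_mul_theta4_sub_le hαV hy
  have h3 := mul_lt_mul_of_pos_right (hW _ hw) hmin
  simp only [FV, mul_one, div_one]
  linarith
end
end

section
/- Let d ≥ 1 and a = (a₁,…,a_d) ∈ (0,∞)^d. Let μ be a nonnegative Borel measure on (0,∞) such that f(r) := ∫₀^∞ e^{−rt} dμ(t) is finite for every r > 0 and f(r) = O(r^{−s}) as r → ∞ for some s > d/2. Then the alternating lattice sum Σ_{n∈ℤ^d∖{0}} (−1)^{n₁+⋯+n_d} f(Q_a(n)) converges absolutely and equals ∫₀^∞ ( ∏_{i=1}^d θ₄(a_i²·t/π) − 1 ) dμ(t), the integral being absolutely convergent. -/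
open MeasureTheory Set Filter

noncomputable section

/-- Quadratic form of the orthorhombic lattice `L_a = a₁ℤ × ⋯ × a_dℤ`:
`Q_a(n) = a₁²n₁² + ⋯ + a_d²n_d²`. -/
def Qf (d : ℕ) (a : Fin d → ℝ) (n : Fin d → ℤ) : ℝ :=
  ∑ i, (a i) ^ 2 * (n i : ℝ) ^ 2

/-- A finite product of summable real families expands as a sum over all tuples. -/
theorem hasSum_prod_fin {κ : Type*} {d : ℕ} (g : Fin d → κ → ℝ) (hg : ∀ i, Summable (g i)) :
    HasSum (fun n : Fin d → κ => ∏ i, g i (n i)) (∏ i, ∑' k, g i k) := by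
  induction d with
  | zero => simp [hasSum_unique]
  | succ d ih =>
    have h1 : HasSum (fun n : Fin d → κ => ∏ i, g i.succ (n i)) (∏ i : Fin d, ∑' k, g i.succ k) :=
      ih (fun i => g i.succ) fun i => hg i.succ
    rw [Fin.prod_univ_succ, ← (Fin.consEquiv fun _ => κ).hasSum_iff]
    have hhead : Summable fun k => ‖g 0 k‖ := (hg 0).norm
    have htail : Summable fun n : Fin d → κ => ‖∏ i, g i.succ (n i)‖ := h1.summable.norm
    have hmul := summable_mul_of_summable_norm hhead htail
    have hprod := (hg 0).hasSum.mul h1 hmul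
    refine hprod.congr_fun fun x => ?_
    simp [Fin.prod_univ_succ]

/-- The sup-norm Epstein series `∑ ‖n‖⁻ˢ` over `ℤᵈ` converges for `s > d`. -/
theorem summable_pi_int_norm_rpow {d : ℕ} (hd : 1 ≤ d) {s : ℝ} (hs : (d : ℝ) < s) :
    Summable fun n : Fin d → ℤ => ‖n‖ ^ (-s) := by
  have hd0 : (0 : ℝ) < d := by exact_mod_cast hd
  have h1 : Summable fun k : ℤ => max 1 |(k : ℝ)| ^ (-(s / d)) := by
    refine (Real.summable_abs_int_rpow ((one_lt_div hd0).2 hs)).congr_cofinite ?_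
    filter_upwards [(Set.finite_singleton (0 : ℤ)).compl_mem_cofinite] with k hk
    have hk' : (1 : ℝ) ≤ |(k : ℝ)| := by exact_mod_cast Int.one_le_abs hk
    rw [max_eq_right hk']
  have h2 := (hasSum_prod_fin (d := d) (fun _ k => max 1 |((k : ℤ) : ℝ)| ^ (-(s / d)))
    fun _ => h1).summable
  refine h2.of_nonneg_of_le (fun n => by positivity) fun n => ?_
  rcases eq_or_ne n 0 with rfl | hn
  · rw [norm_zero, Real.zero_rpow (by linarith)]
    positivity
  have hle (i : Fin d) : max 1 |(n i : ℝ)| ≤ ‖n‖ := by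
    have hcoord (j : Fin d) : |(n j : ℝ)| ≤ ‖n‖ := by
      simpa [Int.norm_eq_abs] using norm_le_pi_norm n j
    obtain ⟨j, hj⟩ := Function.ne_iff.1 hn
    refine max_le (le_trans ?_ (hcoord j)) (hcoord i)
    exact_mod_cast Int.one_le_abs hj
  have hn0 : 0 < ‖n‖ := norm_pos_iff.2 hn
  calc ‖n‖ ^ (-s) = ∏ _i : Fin d, ‖n‖ ^ (-(s / d)) := by
        rw [Finset.prod_const, Finset.card_univ, Fintype.card_fin, ← Real.rpow_mul_natCast hn0.le]
        congr 1
        field_simp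
    _ ≤ ∏ i, max 1 |(n i : ℝ)| ^ (-(s / d)) := by
        refine Finset.prod_le_prod (fun i _ => by positivity) fun i _ => ?_
        exact Real.rpow_le_rpow_of_nonpos (by positivity) (hle i)
          (neg_nonpos.2 (div_nonneg (hd0.le.trans hs.le) hd0.le))

theorem summable_exp_neg_mul_int_sq {c : ℝ} (hc : 0 < c) :
    Summable fun k : ℤ => Real.exp (-(c * (k : ℝ) ^ 2)) := by
  refine (summable_pow_mul_jacobiTheta₂_term_bound 0 (div_pos hc Real.pi_pos) 0).congr fun k => ?_
  have := Real.pi_ne_zero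
  simp only [pow_zero, one_mul]
  congr 1
  field_simp
  ring

theorem neg_one_zpow_sum {ι : Type*} (s : Finset ι) (n : ι → ℤ) :
    (-1 : ℝ) ^ (∑ i ∈ s, n i) = ∏ i ∈ s, (-1 : ℝ) ^ n i := by
  classical
  induction s using Finset.induction_on with
  | empty => simp
  | insert i s hi ih => rw [Finset.sum_insert hi, Finset.prod_insert hi, zpow_add₀ (by norm_num), ih]

/-- `Q_a` dominates a positive multiple of the squared sup norm. -/
theorem exists_mul_norm_sq_le_Qf (d : ℕ) (hd : 1 ≤ d) (a : Fin d → ℝ) (ha : ∀ i, 0 < a i) :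
    ∃ c : ℝ, 0 < c ∧ ∀ n : Fin d → ℤ, c * ‖n‖ ^ 2 ≤ Qf d a n := by
  have : Nonempty (Fin d) := ⟨⟨0, hd⟩⟩
  obtain ⟨i₀, hi₀⟩ := Finite.exists_min a
  refine ⟨a i₀ ^ 2, pow_pos (ha i₀) 2, fun n => ?_⟩
  obtain ⟨j, hj⟩ := Finite.exists_max fun i => ‖n i‖
  have hnj : ‖n‖ ≤ |(n j : ℝ)| := by
    rw [← Int.norm_eq_abs]
    exact (pi_norm_le_iff_of_nonempty n).2 hj
  calc a i₀ ^ 2 * ‖n‖ ^ 2 ≤ a j ^ 2 * |(n j : ℝ)| ^ 2 := by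
        have := ha i₀
        gcongr
        exact hi₀ j
    _ = a j ^ 2 * (n j : ℝ) ^ 2 := by rw [sq_abs]
    _ ≤ Qf d a n := Finset.single_le_sum (f := fun i => a i ^ 2 * (n i : ℝ) ^ 2)
        (fun i _ => by positivity) (Finset.mem_univ j)

/-- A function that decays faster than `r ^ (-d / 2)` is summable along `Q_a` on `ℤᵈ`. -/
theorem summable_comp_Qf (d : ℕ) (hd : 1 ≤ d) (a : Fin d → ℝ) (ha : ∀ i, 0 < a i) {f : ℝ → ℝ}
    {s : ℝ} (hs : (d : ℝ) / 2 < s) (hO : f =O[atTop] fun r : ℝ => r ^ (-s)) :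
    Summable fun n : Fin d → ℤ => f (Qf d a n) := by
  obtain ⟨c, hc, hQ⟩ := exists_mul_norm_sq_le_Qf d hd a ha
  have hnorm : Tendsto (fun n : Fin d → ℤ => ‖n‖) cofinite atTop := by
    rw [← cocompact_eq_cofinite]
    exact tendsto_norm_cocompact_atTop
  have hlim : Tendsto (Qf d a) cofinite atTop :=
    tendsto_atTop_mono hQ (((tendsto_pow_atTop two_ne_zero).comp hnorm).const_mul_atTop hc)
  have hs0 : 0 < s := lt_of_le_of_lt (by positivity) hs
  have hsum := summable_pi_int_norm_rpow hd (s := 2 * s) (by linarith)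
  refine summable_of_isBigO hsum ((hO.comp_tendsto hlim).trans ?_)
  refine Asymptotics.IsBigO.of_bound (c ^ (-s)) ?_
  filter_upwards [hnorm.eventually_gt_atTop 0] with n hn
  have hQ0 : 0 < Qf d a n := lt_of_lt_of_le (by positivity) (hQ n)
  simp only [Function.comp_apply]
  rw [Real.norm_of_nonneg (by positivity), Real.norm_of_nonneg (by positivity)]
  calc Qf d a n ^ (-s) ≤ (c * ‖n‖ ^ 2) ^ (-s) :=
        Real.rpow_le_rpow_of_nonpos (by positivity) (hQ n) (by linarith)
    _ = c ^ (-s) * ‖n‖ ^ (-(2 * s)) := by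
        rw [Real.mul_rpow hc.le (by positivity), ← Real.rpow_natCast_mul hn.le]
        congr 2
        push_cast
        ring

theorem Qf_pos (d : ℕ) (a : Fin d → ℝ) (ha : ∀ i, 0 < a i) {n : Fin d → ℤ} (hn : n ≠ 0) :
    0 < Qf d a n := by
  obtain ⟨j, hj⟩ := Function.ne_iff.1 hn
  have hj' : (n j : ℝ) ≠ 0 := by exact_mod_cast hj
  refine Finset.sum_pos' (fun i _ => by positivity) ⟨j, Finset.mem_univ j, ?_⟩
  have := ha j
  positivity

/-- The alternating Gaussian sum over `ℤᵈ` factors as a product of theta functions. -/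
theorem hasSum_alternating_exp_Qf (d : ℕ) (a : Fin d → ℝ) (ha : ∀ i, 0 < a i) {t : ℝ}
    (ht : 0 < t) :
    HasSum (fun n : Fin d → ℤ => (-1 : ℝ) ^ (∑ i, n i) * Real.exp (-(Qf d a n * t)))
      (∏ i, theta4 (a i ^ 2 * t / Real.pi)) := by
  have hterm (i : Fin d) (k : ℤ) :
      Real.exp (-Real.pi * (a i ^ 2 * t / Real.pi) * (k : ℝ) ^ 2) =
        Real.exp (-(a i ^ 2 * t * (k : ℝ) ^ 2)) := by
    have := Real.pi_ne_zero
    congr 1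
    field_simp
  have h := hasSum_prod_fin
    (fun (i : Fin d) (k : ℤ) =>
      (-1 : ℝ) ^ k * Real.exp (-Real.pi * (a i ^ 2 * t / Real.pi) * (k : ℝ) ^ 2))
    fun i => by
      refine .of_norm ?_
      have hc : 0 < a i ^ 2 * t := by have := ha i; positivity
      refine (summable_exp_neg_mul_int_sq hc).congr fun k => ?_
      rw [hterm, norm_mul, Real.norm_eq_abs, abs_neg_one_zpow, one_mul, Real.norm_eq_abs,
        Real.abs_exp]
  refine h.congr_fun fun n => ?_
  simp only [hterm]
  rw [Finset.prod_mul_distrib, neg_one_zpow_sum, ← Real.exp_sum, Qf, Finset.sum_mul,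
    Finset.sum_neg_distrib]
  congr 3
  exact Finset.sum_congr rfl fun i _ => by ring

theorem hasSum_alternating_exp_Qf_ne_zero (d : ℕ) (a : Fin d → ℝ) (ha : ∀ i, 0 < a i) {t : ℝ}
    (ht : 0 < t) :
    HasSum (fun n : {n : Fin d → ℤ // n ≠ 0} =>
        (-1 : ℝ) ^ (∑ i, n.1 i) * Real.exp (-(Qf d a n.1 * t)))
      ((∏ i, theta4 (a i ^ 2 * t / Real.pi)) - 1) := by
  have h := hasSum_alternating_exp_Qf d a ha ht
  have h0 : HasSum
      ((fun n : Fin d → ℤ => (-1 : ℝ) ^ (∑ i, n i) * Real.exp (-(Qf d a n * t))) ∘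
        ((↑) : ({0} : Set (Fin d → ℤ)) → Fin d → ℤ)) 1 := by
    convert! hasSum_singleton (0 : Fin d → ℤ) fun n : Fin d → ℤ =>
      (-1 : ℝ) ^ (∑ i, n i) * Real.exp (-(Qf d a n * t)) using 1
    simp [Qf]
  refine (h0.hasSum_iff_compl).1 h

/-- The sum of a series whose `L¹` norms are summable is integrable. -/
theorem integrable_tsum_of_summable_integral_norm {α ι E : Type*} [MeasurableSpace α]
    [Countable ι] [NormedAddCommGroup E] [CompleteSpace E] {ν : Measure α} {F : ι → α → E}
    (hF : ∀ i, Integrable (F i) ν) (hsum : Summable fun i => ∫ x, ‖F i x‖ ∂ν) :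
    Integrable (fun x => ∑' i, F i x) ν := by
  refine ⟨AEStronglyMeasurable.tsum fun i => (hF i).1, ?_⟩
  calc ∫⁻ x, ‖∑' i, F i x‖ₑ ∂ν ≤ ∫⁻ x, ∑' i, ‖F i x‖ₑ ∂ν :=
        lintegral_mono fun x => enorm_tsum_le_tsum_enorm
    _ = ∑' i, ENNReal.ofReal (∫ x, ‖F i x‖ ∂ν) := by
        rw [lintegral_tsum fun i => (hF i).1.enorm]
        simp only [ofReal_integral_norm_eq_lintegral_enorm (hF _)]
    _ < ⊤ := hsum.tsum_ofReal_lt_top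

/-- Integral representation of the alternating lattice sum for a completely
monotone potential `f = Laplace transform of a nonnegative measure μ`:
`Σ_{n≠0} (-1)^{n₁+⋯+n_d} f(Q_a(n)) = ∫₀^∞ (∏ᵢ θ₄(aᵢ²t/π) - 1) dμ(t)`. -/
theorem alternating_sum_integral_rep
    (d : ℕ) (hd : 1 ≤ d) (a : Fin d → ℝ) (ha : ∀ i, 0 < a i)
    (μ : Measure ℝ) (f : ℝ → ℝ)
    (hint : ∀ r : ℝ, 0 < r →
      Integrable (fun t => Real.exp (-(r * t))) (μ.restrict (Ioi 0)))
    (hfdef : ∀ r : ℝ, 0 < r → f r = ∫ t in Ioi 0, Real.exp (-(r * t)) ∂μ)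
    (hO : ∃ s : ℝ, s > d / 2 ∧ f =O[atTop] fun r : ℝ => r ^ (-s)) :
    Summable (fun n : {n : Fin d → ℤ // n ≠ 0} =>
      (-1 : ℝ) ^ (∑ i, n.1 i) * f (Qf d a n.1)) ∧
    Integrable (fun t => (∏ i, theta4 ((a i) ^ 2 * t / Real.pi)) - 1)
      (μ.restrict (Ioi 0)) ∧
    (∑' n : {n : Fin d → ℤ // n ≠ 0}, (-1 : ℝ) ^ (∑ i, n.1 i) * f (Qf d a n.1))
      = ∫ t in Ioi 0, ((∏ i, theta4 ((a i) ^ 2 * t / Real.pi)) - 1) ∂μ := by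
  obtain ⟨s, hs, hO⟩ := hO
  set F : {n : Fin d → ℤ // n ≠ 0} → ℝ → ℝ := fun n t =>
    (-1 : ℝ) ^ (∑ i, n.1 i) * Real.exp (-(Qf d a n.1 * t)) with hF
  have hFint (n) : Integrable (F n) (μ.restrict (Ioi 0)) :=
    (hint _ (Qf_pos d a ha n.2)).const_mul _
  have hFnorm (n : {n : Fin d → ℤ // n ≠ 0}) : ∫ t in Ioi 0, ‖F n t‖ ∂μ = f (Qf d a n.1) := by
    simp only [hF, norm_mul, Real.norm_eq_abs, abs_neg_one_zpow, one_mul, Real.abs_exp]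
    exact (hfdef _ (Qf_pos d a ha n.2)).symm
  have hFintegral (n : {n : Fin d → ℤ // n ≠ 0}) :
      ∫ t in Ioi 0, F n t ∂μ = (-1 : ℝ) ^ (∑ i, n.1 i) * f (Qf d a n.1) := by
    rw [hfdef _ (Qf_pos d a ha n.2), ← integral_const_mul]
  have hsum : Summable fun n => ∫ t in Ioi 0, ‖F n t‖ ∂μ := by
    simp only [hFnorm]
    exact (summable_comp_Qf d hd a ha hs hO).subtype _
  have htheta : (fun t => ∑' n, F n t) =ᵐ[μ.restrict (Ioi 0)]
      fun t => (∏ i, theta4 ((a i) ^ 2 * t / Real.pi)) - 1 := by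
    filter_upwards [ae_restrict_mem measurableSet_Ioi] with t ht
    exact (hasSum_alternating_exp_Qf_ne_zero d a ha ht).tsum_eq
  have hmain := hasSum_integral_of_summable_integral_norm hFint hsum
  simp only [hFintegral, integral_congr_ae htheta] at hmain
  exact ⟨hmain.summable, (integrable_tsum_of_summable_integral_norm hFint hsum).congr htheta,
    hmain.tsum_eq⟩
end
end
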